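/- arXiv:2002.06482 — 2 statements merged into one kernel-verified Lean document; each statement's English description precedes it below -/
import Mathlib

section
/- Let c ≥ 2 be an integer and L(p, j) a bounded measurable loss on predictions and labels satisfying the bounded-sum condition: there exist constants C_1 ≤ C_2 such that C_1 ≤ Σ_{j=1}^c L(p, j) ≤ C_2 for every prediction p. Let 0 ≤ η < 1 − 1/c. If f* is a global minimizer of the clean risk R_L over all measurable classifiers and f̂ is a global minimizer of the symmetric-noise risk R_L^η over all measurable classifiers, then (η·(C_1 − C_2))/(c − 1 − ηc) ≤ R_L(f*) − R_L(f̂) ≤ 0. -/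
open MeasureTheory

/-- A prediction: a probability vector over `c` classes. -/
def IsPred (c : ℕ) (p : Fin c → ℝ) : Prop :=
  (∀ j, 0 ≤ p j) ∧ ∑ j, p j = 1

/-- A classifier: a measurable map into the set of predictions. -/
def IsClassifier {X : Type*} [MeasurableSpace X] (c : ℕ) (f : X → Fin c → ℝ) : Prop :=
  Measurable f ∧ ∀ x, IsPred c (f x)

/-- Clean risk `R_L(f) = E_{(x,y)∼μ}[L(f(x), y)]`. -/
noncomputable def cleanRisk {X : Type*} [MeasurableSpace X] {c : ℕ}
    (μ : Measure (X × Fin c)) (L : (Fin c → ℝ) → Fin c → ℝ) (f : X → Fin c → ℝ) : ℝ :=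
  ∫ z, L (f z.1) z.2 ∂μ

/-- Risk under symmetric label noise of rate `η`:
`R_L^η(f) = E[(1−η)·L(f(x), y) + (η/(c−1))·Σ_{j≠y} L(f(x), j)]`. -/
noncomputable def noisyRisk {X : Type*} [MeasurableSpace X] {c : ℕ}
    (μ : Measure (X × Fin c)) (L : (Fin c → ℝ) → Fin c → ℝ) (η : ℝ)
    (f : X → Fin c → ℝ) : ℝ :=
  ∫ z, ((1 - η) * L (f z.1) z.2
    + (η / ((c : ℝ) - 1)) * ∑ j ∈ Finset.univ.erase z.2, L (f z.1) j) ∂μ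

/-- The noisy risk is an affine combination of the clean risk and the expected total loss. -/
theorem noisyRisk_eq {X : Type*} [MeasurableSpace X] {c : ℕ} (hc : 2 ≤ c)
    (μ : Measure (X × Fin c)) (L : (Fin c → ℝ) → Fin c → ℝ) (η : ℝ) (f : X → Fin c → ℝ)
    (hclean : Integrable (fun z : X × Fin c => L (f z.1) z.2) μ)
    (htotal : Integrable (fun z : X × Fin c => ∑ j, L (f z.1) j) μ) :
    noisyRisk μ L η f = (((c : ℝ) - 1 - η * c) / ((c : ℝ) - 1)) * cleanRisk μ L f
      + (η / ((c : ℝ) - 1)) * ∫ z, ∑ j, L (f z.1) j ∂μ := by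
  have hc' : (c : ℝ) - 1 ≠ 0 := by
    have : (2 : ℝ) ≤ c := by exact_mod_cast hc
    linarith
  unfold noisyRisk cleanRisk
  rw [← integral_const_mul, ← integral_const_mul,
    ← integral_add (hclean.const_mul _) (htotal.const_mul _)]
  congr 1 with z
  rw [← Finset.add_sum_erase _ _ (Finset.mem_univ z.2)]
  field_simp
  ring

/-- A measurable loss that is bounded on predictions is integrable along any classifier. -/
theorem IsClassifier.integrable_loss {X : Type*} [MeasurableSpace X] {c : ℕ}
    {μ : Measure (X × Fin c)} [IsFiniteMeasure μ] {L : (Fin c → ℝ) → Fin c → ℝ}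
    (hLmeas : Measurable fun pj : (Fin c → ℝ) × Fin c => L pj.1 pj.2)
    (hLbd : ∃ B : ℝ, ∀ p : Fin c → ℝ, IsPred c p → ∀ j, |L p j| ≤ B)
    {f : X → Fin c → ℝ} (hf : IsClassifier c f)
    {g : X × Fin c → Fin c} (hg : Measurable g) :
    Integrable (fun z => L (f z.1) (g z)) μ := by
  obtain ⟨B, hB⟩ := hLbd
  have hmeas : Measurable fun z : X × Fin c => L (f z.1) (g z) :=
    hLmeas.comp ((hf.1.comp measurable_fst).prodMk hg)
  exact Integrable.of_bound hmeas.aestronglyMeasurable B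
    (.of_forall fun z => hB _ (hf.2 z.1) _)

/-- Bounded-sum losses: clean-risk bound (Ghosh-type result). -/
theorem boundedSum_cleanRisk_bound {X : Type*} [MeasurableSpace X] {c : ℕ} (hc : 2 ≤ c)
    (μ : Measure (X × Fin c)) [IsProbabilityMeasure μ]
    (L : (Fin c → ℝ) → Fin c → ℝ)
    (hLmeas : Measurable fun pj : (Fin c → ℝ) × Fin c => L pj.1 pj.2)
    (hLbd : ∃ B : ℝ, ∀ p : Fin c → ℝ, IsPred c p → ∀ j, |L p j| ≤ B)
    (C₁ C₂ : ℝ) (hC : C₁ ≤ C₂)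
    (hsum : ∀ p : Fin c → ℝ, IsPred c p → C₁ ≤ ∑ j, L p j ∧ ∑ j, L p j ≤ C₂)
    (η : ℝ) (hη0 : 0 ≤ η) (hη1 : η < 1 - 1 / (c : ℝ))
    (fstar fhat : X → Fin c → ℝ)
    (hfstar : IsClassifier c fstar) (hfhat : IsClassifier c fhat)
    (hmin_clean : ∀ g, IsClassifier c g → cleanRisk μ L fstar ≤ cleanRisk μ L g)
    (hmin_noisy : ∀ g, IsClassifier c g → noisyRisk μ L η fhat ≤ noisyRisk μ L η g) :
    η * (C₁ - C₂) / ((c : ℝ) - 1 - η * c) ≤ cleanRisk μ L fstar - cleanRisk μ L fhat ∧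
    cleanRisk μ L fstar - cleanRisk μ L fhat ≤ 0 := by
  have hc2 : (2 : ℝ) ≤ c := by exact_mod_cast hc
  have hc1 : (0 : ℝ) < (c : ℝ) - 1 := by linarith
  have hden : (0 : ℝ) < (c : ℝ) - 1 - η * c := by
    have h := mul_lt_mul_of_pos_right hη1 (by linarith : (0 : ℝ) < c)
    rw [sub_mul, one_mul, one_div_mul_cancel (by linarith)] at h
    linarith
  have hclean {f : X → Fin c → ℝ} (hf : IsClassifier c f) :
      Integrable (fun z : X × Fin c => L (f z.1) z.2) μ :=
    hf.integrable_loss hLmeas hLbd measurable_snd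
  have htotal {f : X → Fin c → ℝ} (hf : IsClassifier c f) :
      Integrable (fun z : X × Fin c => ∑ j, L (f z.1) j) μ :=
    integrable_finsetSum _ fun j _ => hf.integrable_loss hLmeas hLbd measurable_const
  have hlower : C₁ ≤ ∫ z, ∑ j, L (fhat z.1) j ∂μ := by
    simpa using integral_mono (integrable_const C₁) (htotal hfhat)
      fun z => (hsum _ (hfhat.2 z.1)).1
  have hupper : ∫ z, ∑ j, L (fstar z.1) j ∂μ ≤ C₂ := by
    simpa using integral_mono (htotal hfstar) (integrable_const C₂)
      fun z => (hsum _ (hfstar.2 z.1)).2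
  have hnoisy := hmin_noisy fstar hfstar
  rw [noisyRisk_eq hc μ L η fhat (hclean hfhat) (htotal hfhat),
    noisyRisk_eq hc μ L η fstar (hclean hfstar) (htotal hfstar),
    div_mul_eq_mul_div, div_mul_eq_mul_div, div_mul_eq_mul_div, div_mul_eq_mul_div,
    ← add_div, ← add_div, div_le_div_iff_of_pos_right hc1] at hnoisy
  refine ⟨?_, sub_nonpos.2 (hmin_clean fhat hfhat)⟩
  rw [div_le_iff₀ hden]
  linarith [mul_le_mul_of_nonneg_left hlower hη0, mul_le_mul_of_nonneg_left hupper hη0]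
end

section
/- Let c ≥ 2 be an integer and 0 ≤ t1 < 1. For every prediction p, the sum of the Bi-Tempered losses over all labels satisfies (c − c^{t1}) / ((1−t1)(2−t1)) ≤ Σ_{j=1}^c L_Bi(p, j) ≤ (c−1)/(1−t1) + c(1 − c^{t1−1})/(2−t1); in particular the Bi-Tempered loss satisfies a bounded-sum condition over the labels. -/
/-- Tempered logarithm `log_t(x) = (x^{1−t} − 1)/(1−t)` (real rpow gives `0^{1−t} = 0` for `t < 1`). -/
noncomputable def tLog (t x : ℝ) : ℝ := (x ^ (1 - t) - 1) / (1 - t)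

/-- The Bi-Tempered loss `L_Bi(p, j) = −log_{t1}(p_j) + (1/(2−t1))·(1 − Σ_k p_k^{2−t1})`. -/
noncomputable def biLoss {c : ℕ} (t1 : ℝ) (p : Fin c → ℝ) (j : Fin c) : ℝ :=
  -tLog t1 (p j) + (1 / (2 - t1)) * (1 - ∑ k, (p k) ^ (2 - t1))

theorem sum_biLoss {c : ℕ} (t1 : ℝ) (p : Fin c → ℝ) :
    ∑ j, biLoss t1 p j =
      ((c : ℝ) - ∑ j, p j ^ (1 - t1)) / (1 - t1) +
        c * (1 - ∑ j, p j ^ (2 - t1)) / (2 - t1) := by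
  simp only [biLoss, tLog, Finset.sum_add_distrib, Finset.sum_neg_distrib, ← Finset.sum_div,
    Finset.sum_sub_distrib, Finset.sum_const, Finset.card_univ, Fintype.card_fin, nsmul_eq_mul]
  ring

theorem IsPred.le_one {c : ℕ} {p : Fin c → ℝ} (hp : IsPred c p) (j : Fin c) : p j ≤ 1 :=
  hp.2 ▸ Finset.single_le_sum (fun i _ => hp.1 i) (Finset.mem_univ j)

theorem IsPred.one_le_sum_rpow {c : ℕ} {p : Fin c → ℝ} (hp : IsPred c p) {s : ℝ}
    (hs0 : 0 < s) (hs1 : s ≤ 1) : 1 ≤ ∑ j, p j ^ s := by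
  rw [← hp.2]
  refine Finset.sum_le_sum fun j _ => ?_
  rcases (hp.1 j).eq_or_lt with h | h
  · rw [← h, Real.zero_rpow hs0.ne']
  · simpa using Real.rpow_le_rpow_of_exponent_ge h (hp.le_one j) hs1

theorem IsPred.sum_rpow_le_one {c : ℕ} {p : Fin c → ℝ} (hp : IsPred c p) {r : ℝ}
    (hr : 1 ≤ r) : ∑ j, p j ^ r ≤ 1 := by
  rw [← hp.2]
  refine Finset.sum_le_sum fun j _ => ?_
  rcases (hp.1 j).eq_or_lt with h | h
  · rw [← h, Real.zero_rpow (by linarith)]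
  · simpa using Real.rpow_le_rpow_of_exponent_ge h (hp.le_one j) hr

theorem IsPred.rpow_le_sum_rpow {c : ℕ} (hc : 0 < c) {p : Fin c → ℝ} (hp : IsPred c p)
    {r : ℝ} (hr : 1 ≤ r) : (c : ℝ) ^ (1 - r) ≤ ∑ j, p j ^ r := by
  have hc' : (0 : ℝ) < c := by exact_mod_cast hc
  have h := Real.rpow_sum_le_const_mul_sum_rpow_of_nonneg Finset.univ hr
    (fun j _ => hp.1 j)
  rw [hp.2, Real.one_rpow, Finset.card_univ, Fintype.card_fin] at h
  rw [show 1 - r = -(r - 1) by ring, Real.rpow_neg hc'.le]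
  exact (inv_le_iff_one_le_mul₀' (Real.rpow_pos_of_pos hc' _)).2 h

theorem IsPred.sum_rpow_le_rpow {c : ℕ} {p : Fin c → ℝ} (hp : IsPred c p)
    {s : ℝ} (hs0 : 0 < s) (hs1 : s ≤ 1) : ∑ j, p j ^ s ≤ (c : ℝ) ^ (1 - s) := by
  have hA : 0 ≤ ∑ j, p j ^ s := Finset.sum_nonneg fun j _ => Real.rpow_nonneg (hp.1 j) s
  have h := Real.rpow_sum_le_const_mul_sum_rpow_of_nonneg Finset.univ
    ((one_le_inv₀ hs0).2 hs1) (fun j _ => Real.rpow_nonneg (hp.1 j) s)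
  simp only [Real.rpow_rpow_inv (hp.1 _) hs0.ne', hp.2, mul_one, Finset.card_univ,
    Fintype.card_fin] at h
  have h' := Real.rpow_le_rpow (Real.rpow_nonneg hA _) h hs0.le
  rwa [Real.rpow_inv_rpow hA hs0.ne', ← Real.rpow_mul c.cast_nonneg, sub_mul,
    inv_mul_cancel₀ hs0.ne', one_mul] at h'

/-- The Bi-Tempered loss satisfies a bounded-sum condition over the labels. -/
theorem biLoss_sum_bounds {c : ℕ} (hc : 2 ≤ c) (t1 : ℝ) (ht0 : 0 ≤ t1) (ht1 : t1 < 1)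
    (p : Fin c → ℝ) (hp : IsPred c p) :
    ((c : ℝ) - (c : ℝ) ^ t1) / ((1 - t1) * (2 - t1)) ≤ ∑ j, biLoss t1 p j ∧
    ∑ j, biLoss t1 p j ≤
      ((c : ℝ) - 1) / (1 - t1) + c * (1 - (c : ℝ) ^ (t1 - 1)) / (2 - t1) := by
  have hs : 0 < 1 - t1 := by linarith
  have hr : 0 < 2 - t1 := by linarith
  have hc1 : (1 : ℝ) ≤ c := by exact_mod_cast (by omega : 1 ≤ c)
  rw [sum_biLoss]
  constructor
  · have hA := hp.sum_rpow_le_rpow hs (by linarith)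
    rw [sub_sub_cancel] at hA
    have hB := hp.sum_rpow_le_one (r := 2 - t1) (by linarith)
    have hcc : (c : ℝ) ^ t1 ≤ c := by
      simpa using Real.rpow_le_rpow_of_exponent_le hc1 ht1.le
    calc ((c : ℝ) - (c : ℝ) ^ t1) / ((1 - t1) * (2 - t1))
        ≤ ((c : ℝ) - (c : ℝ) ^ t1) / (1 - t1) :=
          div_le_div_of_nonneg_left (by linarith) hs
            (le_mul_of_one_le_right hs.le (by linarith))
      _ ≤ ((c : ℝ) - ∑ j, p j ^ (1 - t1)) / (1 - t1) := by gcongr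
      _ ≤ _ := le_add_of_nonneg_right
          (div_nonneg (mul_nonneg (by linarith) (by linarith)) hr.le)
  · have hA := hp.one_le_sum_rpow hs (by linarith)
    have hB := hp.rpow_le_sum_rpow (by omega) (r := 2 - t1) (by linarith)
    rw [show 1 - (2 - t1) = t1 - 1 by ring] at hB
    gcongr
end
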